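/- Let ν be an R-AMS channel from A to B that is ergodic with respect to ergodic R-AMS sources (i.e., for every probability measure η on A that is ergodic, recurrent and AMS under T_A, the hookup ην is ergodic, recurrent and AMS under T_{AB}). Let μ be a probability measure on A that is ergodic, recurrent and AMS under T_A, with stationary mean μ̄. Let ν̄_μ be a channel with μ̄ν̄_μ equal to the stationary mean of μν, and let ν̄_{μ̄} be a channel with μ̄ν̄_{μ̄} equal to the stationary mean of μ̄ν. Then ν̄_μ(x,·) = ν̄_{μ̄}(x,·) for μ̄-almost every x (and hence for μ-almost every x). -/

import Mathlib

open MeasureTheory ProbabilityTheory Filter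

/-- A probability measure `η` is stationary under `T` if `η (T ⁻¹' F) = η F`
for all measurable `F`. -/
def Stationary {α : Type*} [MeasurableSpace α] (T : α → α)
    (η : MeasureTheory.Measure α) : Prop :=
  ∀ F : Set α, MeasurableSet F → η (T ⁻¹' F) = η F

/-- A probability measure `η` is recurrent under `T` if
`η (F \ ⋃_{k ≥ 1} T^{-k} F) = 0` for all measurable `F`. -/
def Recurrent {α : Type*} [MeasurableSpace α] (T : α → α)
    (η : MeasureTheory.Measure α) : Prop :=
  ∀ F : Set α, MeasurableSet F → η (F \ ⋃ k : ℕ, (T^[k + 1]) ⁻¹' F) = 0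

/-- A probability measure `η` is asymptotically mean stationary (AMS) under `T` if the
Cesàro averages `(1/n) ∑_{k<n} η (T^{-k} F)` converge for every measurable `F`. -/
def IsAMS {α : Type*} [MeasurableSpace α] (T : α → α)
    (η : MeasureTheory.Measure α) : Prop :=
  ∀ F : Set α, MeasurableSet F → ∃ L : ℝ,
    Filter.Tendsto
      (fun n : ℕ => (∑ k ∈ Finset.range n, (η ((T^[k]) ⁻¹' F)).toReal) / (n : ℝ))
      Filter.atTop (nhds L)

/-- `η'` is the stationary mean of `η` under `T`: the Cesàro averages
`(1/n) ∑_{k<n} η (T^{-k} F)` converge to `η' F` for every measurable `F`. -/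
def IsStationaryMean {α : Type*} [MeasurableSpace α] (T : α → α)
    (η η' : MeasureTheory.Measure α) : Prop :=
  ∀ F : Set α, MeasurableSet F →
    Filter.Tendsto
      (fun n : ℕ => (∑ k ∈ Finset.range n, (η ((T^[k]) ⁻¹' F)).toReal) / (n : ℝ))
      Filter.atTop (nhds ((η' F).toReal))

/-- A probability measure `η` is ergodic under `T` if every strictly invariant
measurable set has measure `0` or `1`. -/
def ErgodicShift {α : Type*} [MeasurableSpace α] (T : α → α)
    (η : MeasureTheory.Measure α) : Prop :=
  ∀ F : Set α, MeasurableSet F → T ⁻¹' F = F → η F = 0 ∨ η F = 1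

section AsymptoticMean

variable {α : Type*} [MeasurableSpace α] {T : α → α}

lemma measure_preimage_iterate_of_invariant {η : Measure α} {F : Set α}
    (hinv : T ⁻¹' F = F) (n : ℕ) : η (T^[n] ⁻¹' F) = η F := by
  congr 1
  rw [Set.preimage_iterate_eq]
  exact Function.iterate_fixed hinv n

lemma tendsto_cesaro_const {u : ℕ → ℝ} {c : ℝ} (hu : ∀ n, u n = c) :
    Tendsto (fun n : ℕ => (∑ k ∈ Finset.range n, u k) / (n : ℝ)) atTop (nhds c) := by
  refine tendsto_const_nhds.congr' ?_
  filter_upwards [eventually_gt_atTop 0] with n hn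
  have : (n : ℝ) ≠ 0 := by positivity
  simp only [hu, Finset.sum_const, Finset.card_range, nsmul_eq_mul]
  field_simp

lemma Stationary.measurePreserving {η : Measure α} (h : Stationary T η) (hT : Measurable T) :
    MeasurePreserving T η η :=
  ⟨hT, by
    ext F hF
    rw [Measure.map_apply hT hF, h F hF]⟩

lemma Stationary.recurrent {η : Measure α} [IsFiniteMeasure η] (h : Stationary T η)
    (hT : Measurable T) : Recurrent T η := by
  intro F hF
  have hcons := (h.measurePreserving hT).conservative
  refine measure_mono_null ?_
    (hcons.measure_mem_forall_ge_image_notMem_eq_zero hF.nullMeasurableSet 1)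
  rintro x ⟨hxF, hx⟩
  refine ⟨hxF, fun m hm hmem => hx ?_⟩
  obtain ⟨k, rfl⟩ := Nat.exists_eq_add_of_le' hm
  exact Set.mem_iUnion.mpr ⟨k, hmem⟩

lemma Stationary.measure_preimage_iterate {η : Measure α} (h : Stationary T η) {F : Set α}
    (hF : MeasurableSet F) (hT : Measurable T) (n : ℕ) : η (T^[n] ⁻¹' F) = η F :=
  ((h.measurePreserving hT).iterate n).measure_preimage hF.nullMeasurableSet

lemma Recurrent.ae_mem_imp_frequently {η : Measure α} (h : Recurrent T η) (hT : Measurable T)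
    {F : Set α} (hF : MeasurableSet F) :
    ∀ᵐ x ∂η, x ∈ F → ∃ᶠ n in atTop, T^[n] x ∈ F := by
  -- The points which visit `F` for the last time at time `k` never return to that set.
  let G : ℕ → Set α := fun k => {x | T^[k] x ∈ F ∧ ∀ j, k < j → T^[j] x ∉ F}
  have hGm : ∀ k, MeasurableSet (G k) := fun k => by
    have : G k = T^[k] ⁻¹' F ∩ ⋂ j, ⋂ (_ : k < j), (T^[j] ⁻¹' F)ᶜ := by
      ext x
      simp [G]
    rw [this]
    exact (hT.iterate k hF).inter
      (MeasurableSet.iInter fun j => MeasurableSet.iInter fun _ => (hT.iterate j hF).compl)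
  have hG : ∀ k, η (G k) = 0 := fun k => by
    refine measure_mono_null (fun x (hx : x ∈ G k) => Set.mem_sdiff_of_mem hx fun hret => ?_)
      (h (G k) (hGm k))
    obtain ⟨j, hj⟩ := Set.mem_iUnion.mp hret
    refine hx.2 (k + (j + 1)) (by omega) ?_
    rw [Function.iterate_add_apply]
    exact hj.1
  have hae : ∀ᵐ x ∂η, ∀ k, x ∉ G k := ae_all_iff.mpr fun k =>
    measure_eq_zero_iff_ae_notMem.mp (hG k)
  filter_upwards [hae] with x hx hxF
  by_contra hnot
  classical
  obtain ⟨N, hN⟩ := eventually_atTop.mp (not_frequently.mp hnot)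
  have hlt : ∀ n, T^[n] x ∈ F → n ≤ N := fun n hn => by
    by_contra hc
    exact hN n (by omega) hn
  refine hx (Nat.findGreatest (fun n => T^[n] x ∈ F) N)
    ⟨Nat.findGreatest_spec (P := fun n => T^[n] x ∈ F) (Nat.zero_le N) hxF, fun j hj hjF => ?_⟩
  exact absurd hjF (Nat.findGreatest_is_greatest hj (hlt j hjF))

section

variable {η η' : Measure α} [IsProbabilityMeasure η] [IsProbabilityMeasure η']

lemma IsStationaryMean.apply_eq_of_invariant (h : IsStationaryMean T η η') {F : Set α}
    (hF : MeasurableSet F) (hinv : T ⁻¹' F = F) : η' F = η F := by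
  have hconst := tendsto_cesaro_const (c := (η F).toReal)
    (u := fun k => (η (T^[k] ⁻¹' F)).toReal)
    fun n => by rw [measure_preimage_iterate_of_invariant hinv]
  exact (ENNReal.toReal_eq_toReal_iff' (measure_ne_top _ _) (measure_ne_top _ _)).mp
    (tendsto_nhds_unique (h F hF) hconst)

lemma IsStationaryMean.stationary (h : IsStationaryMean T η η') (hT : Measurable T) :
    Stationary T η' := by
  intro F hF
  refine (ENNReal.toReal_eq_toReal_iff' (measure_ne_top _ _) (measure_ne_top _ _)).mp ?_
  refine sub_eq_zero.mp (tendsto_nhds_unique ((h _ (hT hF)).sub (h F hF)) ?_)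
  refine squeeze_zero_norm (a := fun n : ℕ => 1 / (n : ℝ)) (fun n => ?_)
    tendsto_one_div_atTop_nhds_zero_nat
  have hshift : ∀ k, (η (T^[k] ⁻¹' (T ⁻¹' F))).toReal = (η (T^[k + 1] ⁻¹' F)).toReal := fun k => by
    rw [← Set.preimage_comp, ← Function.iterate_succ']
  simp only [hshift]
  rw [← sub_div, ← Finset.sum_sub_distrib,
    Finset.sum_range_sub (fun k => (η (T^[k] ⁻¹' F)).toReal), norm_div, RCLike.norm_natCast]
  gcongr
  rw [Real.norm_eq_abs, abs_le]
  have h1 : ∀ S : Set α, (η S).toReal ≤ 1 := fun S => measureReal_le_one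
  have h0 : ∀ S : Set α, 0 ≤ (η S).toReal := fun S => ENNReal.toReal_nonneg
  constructor <;> linarith [h1 (T^[n] ⁻¹' F), h0 (T^[n] ⁻¹' F), h1 (T^[0] ⁻¹' F), h0 (T^[0] ⁻¹' F)]

lemma IsStationaryMean.absolutelyContinuous (h : IsStationaryMean T η η') (hT : Measurable T)
    (hrec : Recurrent T η) : η ≪ η' := by
  refine Measure.AbsolutelyContinuous.mk fun F hF hF0 => ?_
  let L : Set α := {x | ∃ᶠ n in atTop, T^[n] x ∈ F}
  have hLm : MeasurableSet L := by
    have : L = ⋂ N, ⋃ n, ⋃ (_ : N ≤ n), T^[n] ⁻¹' F := by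
      ext x
      simp [L, frequently_atTop]
    rw [this]
    exact MeasurableSet.iInter fun N => MeasurableSet.iUnion fun n =>
      MeasurableSet.iUnion fun _ => hT.iterate n hF
  have hLinv : T ⁻¹' L = L := by
    ext x
    have := Filter.map_add_atTop_eq_nat 1
    simp only [L, Set.mem_preimage, Set.mem_ofPred_eq, ← Function.iterate_succ_apply]
    conv_rhs => rw [← this, frequently_map]
  have hL0 : η' L = 0 := by
    have hsub : L ⊆ ⋃ n, T^[n] ⁻¹' F := fun x hx =>
      Set.mem_iUnion.mpr (Frequently.exists hx)
    refine measure_mono_null hsub (measure_iUnion_null fun n => ?_)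
    rw [(h.stationary hT).measure_preimage_iterate hF hT, hF0]
  rw [h.apply_eq_of_invariant hLm hLinv] at hL0
  rw [measure_eq_zero_iff_ae_notMem]
  filter_upwards [hrec.ae_mem_imp_frequently hT hF, measure_eq_zero_iff_ae_notMem.mp hL0]
    with x hx hxL hxF using hxL (hx hxF)

end

lemma Stationary.isAMS {η : Measure α} (h : Stationary T η) (hT : Measurable T) : IsAMS T η :=
  fun F hF => ⟨(η F).toReal, tendsto_cesaro_const fun n => by
    rw [h.measure_preimage_iterate hF hT]⟩

/-- Two stationary probability measures that agree on invariant sets, where they take only the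
values `0` and `1`, are equal. -/
lemma Stationary.eq_of_ergodicShift {m₁ m₂ : Measure α} [IsProbabilityMeasure m₁]
    [IsProbabilityMeasure m₂] (h₁ : Stationary T m₁) (h₂ : Stationary T m₂) (hT : Measurable T)
    (herg : ErgodicShift T m₂)
    (hinv : ∀ F, MeasurableSet F → T ⁻¹' F = F → m₁ F = m₂ F) : m₁ = m₂ := by
  have hp₁ := h₁.measurePreserving hT
  have hp₂ := h₂.measurePreserving hT
  have hsum : Ergodic T (m₁ + m₂) :=
    { toMeasurePreserving := ⟨hT, by rw [Measure.map_add _ _ hT, hp₁.map_eq, hp₂.map_eq]⟩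
      aeconst_set := fun s hs hTs => by
        rw [eventuallyConst_set]
        rcases herg s hs hTs with h0 | h1
        · right
          have h0' := (hinv s hs hTs).trans h0
          exact measure_eq_zero_iff_ae_notMem.mp (by simp [h0, h0'])
        · left
          have h1' := (hinv s hs hTs).trans h1
          rw [← prob_compl_eq_zero_iff hs] at h1 h1'
          exact mem_ae_iff.mpr (by simp [h1, h1']) }
  obtain ⟨c, hc⟩ := hsum.eq_smul_of_absolutelyContinuous hp₁
    (Measure.AbsolutelyContinuous.rfl.add_right m₂)
  obtain ⟨d, hd⟩ := hsum.eq_smul_of_absolutelyContinuous hp₂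
    (add_comm m₂ m₁ ▸ Measure.AbsolutelyContinuous.rfl.add_right m₁)
  have hcu := congrArg (fun m : Measure α => m Set.univ) hc
  have hdu := congrArg (fun m : Measure α => m Set.univ) hd
  simp only [Measure.smul_apply, Measure.add_apply, measure_univ, smul_eq_mul] at hcu hdu
  have hcd : c = d :=
    (ENNReal.mul_left_inj (by norm_num) (by norm_num)).mp (hcu.symm.trans hdu)
  rw [hc, hcd, ← hd]

lemma IsStationaryMean.eq_of_absolutelyContinuous {η₁ η₂ m₁ m₂ : Measure α}
    [IsProbabilityMeasure η₁] [IsProbabilityMeasure η₂] [IsProbabilityMeasure m₁]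
    [IsProbabilityMeasure m₂] (h₁ : IsStationaryMean T η₁ m₁) (hT : Measurable T)
    (h₂ : IsStationaryMean T η₂ m₂) (herg : ErgodicShift T η₂) (hac : η₁ ≪ η₂) : m₁ = m₂ := by
  refine (h₁.stationary hT).eq_of_ergodicShift (h₂.stationary hT) hT (fun F hF hinv => ?_)
    fun F hF hinv => ?_
  · rw [h₂.apply_eq_of_invariant hF hinv]
    exact herg F hF hinv
  · rw [h₁.apply_eq_of_invariant hF hinv, h₂.apply_eq_of_invariant hF hinv]
    rcases herg F hF hinv with h0 | h1
    · rw [h0, hac h0]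
    · rw [h1, ← prob_compl_eq_zero_iff hF]
      exact hac ((prob_compl_eq_zero_iff hF).mpr h1)

end AsymptoticMean

theorem stmt15 {A B : Type*} [MeasurableSpace A] [MeasurableSpace B]
    [StandardBorelSpace A] [StandardBorelSpace B]
    (TA : A → A) (TB : B → B) (hTA : Measurable TA) (hTB : Measurable TB)
    (ν : Kernel A B) [IsMarkovKernel ν]
    (hrams : ∀ (η : Measure A) [IsProbabilityMeasure η],
      Recurrent TA η → IsAMS TA η →
        Recurrent (Prod.map TA TB) (η ⊗ₘ ν) ∧ IsAMS (Prod.map TA TB) (η ⊗ₘ ν))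
    (herg : ∀ (η : Measure A) [IsProbabilityMeasure η],
      ErgodicShift TA η → Recurrent TA η → IsAMS TA η →
        ErgodicShift (Prod.map TA TB) (η ⊗ₘ ν) ∧
          Recurrent (Prod.map TA TB) (η ⊗ₘ ν) ∧ IsAMS (Prod.map TA TB) (η ⊗ₘ ν))
    (μ : Measure A) [IsProbabilityMeasure μ]
    (hμerg : ErgodicShift TA μ) (hμrec : Recurrent TA μ) (hμams : IsAMS TA μ)
    (μbar : Measure A) [IsProbabilityMeasure μbar]
    (hμbar : IsStationaryMean TA μ μbar)
    (νbarμ : Kernel A B) [IsMarkovKernel νbarμ]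
    (hνbarμ : IsStationaryMean (Prod.map TA TB) (μ ⊗ₘ ν) (μbar ⊗ₘ νbarμ))
    (νbarμbar : Kernel A B) [IsMarkovKernel νbarμbar]
    (hνbarμbar : IsStationaryMean (Prod.map TA TB) (μbar ⊗ₘ ν) (μbar ⊗ₘ νbarμbar)) :
    (∀ᵐ x ∂μbar, νbarμ x = νbarμbar x) ∧ (∀ᵐ x ∂μ, νbarμ x = νbarμbar x) := by
  have hμstat := hμbar.stationary hTA
  have hac : μ ≪ μbar := hμbar.absolutelyContinuous hTA hμrec
  have hμbarerg : ErgodicShift TA μbar := fun F hF hinv => by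
    rw [hμbar.apply_eq_of_invariant hF hinv]
    exact hμerg F hF hinv
  have hprod : (μ ⊗ₘ ν) ≪ (μbar ⊗ₘ ν) := hac.compProd_left ν
  have herg_bar := (herg μbar hμbarerg (hμstat.recurrent hTA) (hμstat.isAMS hTA)).1
  have heq : μbar ⊗ₘ νbarμ = μbar ⊗ₘ νbarμbar :=
    hνbarμ.eq_of_absolutelyContinuous (hTA.prodMap hTB) hνbarμbar herg_bar hprod
  have hae : ∀ᵐ x ∂μbar, νbarμ x = νbarμbar x := Kernel.compProd_eq_iff.mp heq
  exact ⟨hae, hac.ae_le hae⟩
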